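/- Intermediate Carleman estimate with boundary time-derivative term: There exist C > 0 and s0 > 0 such that for every T > 0, every a ≥ 0, every ε ∈ (0,1), every s ≥ s0 ( ε^{−1}(T + T²) + a^{1/2} ε^{−1/2} T² ), and every classical solution φ of (S'^a): s^{−1} ∫∫_Q w^{−1} e^{−2sα} |∂_t φ|² dx dt + ε² s³ ( ∫∫_Q w³ e^{−2sα} |φ|² dx dt + ∫_0^T [ (w³ e^{−2sα} |φ|²)(t,0) + (w³ e^{−2sα} |φ|²)(t,−1) ] dt ) + ε² s ∫_0^T (w e^{−2sα} |∂_x φ|²)(t,−1) dt ≤ C ( ε² s³ ∫_0^T [ (w³ + T² w⁵) e^{−2sα} |φ|² ](t,0) dt + ε² s ∫_0^T (w e^{−2sα} |∂_t φ|²)(t,0) dt ). -/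

import Mathlib

open Real MeasureTheory intervalIntegral Set

noncomputable section

/-- A classical solution of the one-dimensional adjoint system `(S'^a)`:
`φ ∈ C^∞`, satisfying `∂_t φ + ∂_x φ + ε ∂_x² φ − a φ = 0` on `Q = (0,T)×(−1,0)`,
the boundary condition `ε(∂_t φ(t,0) − ∂_x φ(t,0)) − φ(t,0) = 0` and
`∂_t φ(t,−1) + ∂_x φ(t,−1) = 0` for `t ∈ (0,T)`. -/
def IsAdjSol1D (T ε a : ℝ) (φ : ℝ → ℝ → ℝ) : Prop :=
  ContDiff ℝ (⊤ : ℕ∞) (fun p : ℝ × ℝ => φ p.1 p.2) ∧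
  (∀ t ∈ Set.Ioo (0:ℝ) T, ∀ x ∈ Set.Ioo (-1:ℝ) 0,
    deriv (fun s => φ s x) t + deriv (fun y => φ t y) x
      + ε * deriv (deriv (fun y => φ t y)) x - a * φ t x = 0) ∧
  (∀ t ∈ Set.Ioo (0:ℝ) T,
    ε * (deriv (fun s => φ s 0) t - deriv (fun y => φ t y) 0) - φ t 0 = 0) ∧
  (∀ t ∈ Set.Ioo (0:ℝ) T,
    deriv (fun s => φ s (-1)) t + deriv (fun y => φ t y) (-1) = 0)

/-- The squared `X¹`-norm: `‖ψ‖²_{X¹} = ∫_{−1}^0 |ψ|² + ε(|ψ(0)|² + |ψ(−1)|²)`. -/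
def X1normSq (ε : ℝ) (ψ : ℝ → ℝ) : ℝ :=
  (∫ x in (-1:ℝ)..0, ψ x ^ 2) + ε * (ψ 0 ^ 2 + ψ (-1) ^ 2)

/-- Carleman weight `α(t,x) = (e³ − e^{2+x})/(t(T−t))`. -/
def carlA (T t x : ℝ) : ℝ := (Real.exp 3 - Real.exp (2 + x)) / (t * (T - t))

/-- Carleman weight `w(t,x) = e^{2+x}/(t(T−t))` (denoted `φ` in the paper). -/
def carlW (T t x : ℝ) : ℝ := Real.exp (2 + x) / (t * (T - t))

/-- The smooth extension by zero of `exp (-σ α)` across `t = 0` and `t = T`. -/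
def carlE (T σ : ℝ) (p : ℝ × ℝ) : ℝ :=
  expNegInvGlue (p.1 * (T - p.1) / (σ * (exp 3 - exp (2 + p.2))))

/-- The logarithmic derivative of `t (T - t)`. -/
def carlM (T t : ℝ) : ℝ := (T - 2 * t) / (t * (T - t))

lemma exp_three_sub_pos {x : ℝ} (hx : x < 1) : 0 < exp 3 - exp (2 + x) :=
  sub_pos.2 (exp_lt_exp.2 (by linarith))

lemma carlE_eq_exp {T σ t x : ℝ} (hσ : 0 < σ) (ht : t ∈ Ioo 0 T) (hx : x < 1) :
    carlE T σ (t, x) = exp (-σ * carlA T t x) := by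
  have hβ : 0 < t * (T - t) := mul_pos ht.1 (sub_pos.2 ht.2)
  have hc := exp_three_sub_pos hx
  have h : ¬ t * (T - t) / (σ * (exp 3 - exp (2 + x))) ≤ 0 := not_le.2 (by positivity)
  simp only [carlE, expNegInvGlue, if_neg h, carlA]
  congr 1
  field_simp

lemma carlE_of_time_eq_zero {T σ t : ℝ} (ht : t * (T - t) = 0) (x : ℝ) :
    carlE T σ (t, x) = 0 := by
  simp [carlE, ht, expNegInvGlue.zero]

lemma carlE_nonneg (T σ : ℝ) (p : ℝ × ℝ) : 0 ≤ carlE T σ p := expNegInvGlue.nonneg _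

lemma carlE_mul_self {T σ : ℝ} (hσ : 0 < σ) {p : ℝ × ℝ} (hp : p.2 < 1) :
    carlE T (σ / 2) p * carlE T (σ / 2) p = carlE T σ p := by
  have hc := exp_three_sub_pos hp
  rcases le_or_gt (p.1 * (T - p.1)) 0 with h | h
  · have h1 : ∀ σ > 0, carlE T σ p = 0 := fun σ hσ =>
      expNegInvGlue.zero_of_nonpos (div_nonpos_of_nonpos_of_nonneg h (by positivity))
    rw [h1 σ hσ, h1 _ (half_pos hσ), mul_zero]
  · have h1 : ∀ σ > 0, ¬ p.1 * (T - p.1) / (σ * (exp 3 - exp (2 + p.2))) ≤ 0 :=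
      fun σ hσ => not_le.2 (by positivity)
    simp only [carlE, expNegInvGlue, if_neg (h1 σ hσ), if_neg (h1 _ (half_pos hσ)), ← exp_add]
    congr 1
    field_simp
    ring

/-- Functions whose product with every exponential weight is `C¹` up to `t = 0` and `t = T`. -/
def CarlTame (T : ℝ) (F : ℝ × ℝ → ℝ) : Prop :=
  ∀ σ > 0, ∀ p : ℝ × ℝ, p.2 < 1 → ContDiffAt ℝ 1 (fun p => carlE T σ p * F p) p

namespace CarlTame

variable {T : ℝ} {F G : ℝ × ℝ → ℝ}

lemma contDiffAt_arg {σ : ℝ} (hσ : 0 < σ) {p : ℝ × ℝ} (hp : p.2 < 1) :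
    ContDiffAt ℝ 1
      (fun p : ℝ × ℝ => p.1 * (T - p.1) / (σ * (exp 3 - exp (2 + p.2)))) p := by
  have hc := exp_three_sub_pos hp
  refine ContDiffAt.div (by fun_prop) (by fun_prop) (by positivity)

lemma of_contDiff (hF : ContDiff ℝ 1 F) : CarlTame T F := fun _ hσ p hp =>
  ((expNegInvGlue.contDiff (n := 1)).contDiffAt.comp p (contDiffAt_arg hσ hp)).mul hF.contDiffAt

lemma add (hF : CarlTame T F) (hG : CarlTame T G) : CarlTame T (fun p => F p + G p) :=
  fun σ hσ p hp => by
    simpa only [mul_add] using (hF σ hσ p hp).add (hG σ hσ p hp)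

lemma mul (hF : CarlTame T F) (hG : CarlTame T G) : CarlTame T (fun p => F p * G p) :=
  fun σ hσ p hp => by
    refine ((hF _ (half_pos hσ) p hp).mul (hG _ (half_pos hσ) p hp)).congr_of_eventuallyEq ?_
    filter_upwards [(isOpen_Iio.preimage continuous_snd).mem_nhds hp] with q hq
    rw [← carlE_mul_self hσ hq]
    ring

lemma const (c : ℝ) : CarlTame T (fun _ => c) := of_contDiff contDiff_const

lemma neg (hF : CarlTame T F) : CarlTame T (fun p => - F p) := by
  simpa using (const (-1)).mul hF

lemma sub (hF : CarlTame T F) (hG : CarlTame T G) : CarlTame T (fun p => F p - G p) := by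
  simpa only [sub_eq_add_neg] using hF.add hG.neg

lemma pow (hF : CarlTame T F) (n : ℕ) : CarlTame T (fun p => F p ^ n) := by
  induction n with
  | zero => simpa using const 1
  | succ n ih => simpa only [pow_succ] using ih.mul hF

lemma inv_time : CarlTame T (fun p => (p.1 * (T - p.1))⁻¹) := fun σ hσ p hp => by
  have h := ((expNegInvGlue.contDiff_polynomial_eval_inv_mul (n := 1)
    Polynomial.X).contDiffAt.comp p (contDiffAt_arg (T := T) hσ hp)).mul
    (g := fun p : ℝ × ℝ => (σ * (exp 3 - exp (2 + p.2)))⁻¹)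
    (ContDiffAt.inv (by fun_prop) (mul_pos hσ (exp_three_sub_pos hp)).ne')
  refine h.congr_of_eventuallyEq ?_
  filter_upwards [(isOpen_Iio.preimage continuous_snd).mem_nhds hp] with q hq
  have hc := exp_three_sub_pos hq
  simp only [carlE, Function.comp, Polynomial.eval_X, inv_div]
  field_simp

lemma div_time (hF : CarlTame T F) : CarlTame T (fun p => F p / (p.1 * (T - p.1))) := by
  simpa only [div_eq_mul_inv] using hF.mul inv_time

lemma carlW : CarlTame T (fun p => carlW T p.1 p.2) :=
  (of_contDiff (F := fun p => exp (2 + p.2)) (by fun_prop)).div_time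

lemma carlA : CarlTame T (fun p => carlA T p.1 p.2) :=
  (of_contDiff (F := fun p => exp 3 - exp (2 + p.2)) (by fun_prop)).div_time

lemma carlW_inv : CarlTame T (fun p => (_root_.carlW T p.1 p.2)⁻¹) := by
  simp only [_root_.carlW, inv_div]
  exact of_contDiff (ContDiff.div (by fun_prop) (by fun_prop) fun p => (exp_pos _).ne')

lemma carlM : CarlTame T (fun p => carlM T p.1) :=
  (of_contDiff (F := fun p => T - 2 * p.1) (by fun_prop)).div_time

lemma continuousOn {σ : ℝ} (hF : CarlTame T F) (hσ : 0 < σ) :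
    ContinuousOn (fun p => carlE T σ p * F p) {p | p.2 < 1} := fun p hp =>
  (hF σ hσ p hp).continuousAt.continuousWithinAt

end CarlTame

lemma hasDerivAt_fst_of_differentiableAt {F : ℝ × ℝ → ℝ} {t x : ℝ}
    (hF : DifferentiableAt ℝ F (t, x)) :
    HasDerivAt (fun τ => F (τ, x)) (fderiv ℝ F (t, x) (1, 0)) t :=
  hF.hasFDerivAt.comp_hasDerivAt t ((hasDerivAt_id t).prodMk (hasDerivAt_const t x))

lemma hasDerivAt_snd_of_differentiableAt {F : ℝ × ℝ → ℝ} {t x : ℝ}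
    (hF : DifferentiableAt ℝ F (t, x)) :
    HasDerivAt (fun y => F (t, y)) (fderiv ℝ F (t, x) (0, 1)) x :=
  hF.hasFDerivAt.comp_hasDerivAt x ((hasDerivAt_const x t).prodMk (hasDerivAt_id x))

lemma fderiv_fderiv_apply_comm {F : ℝ × ℝ → ℝ} (hF : ContDiff ℝ (⊤ : ℕ∞) F) (p u v : ℝ × ℝ) :
    fderiv ℝ (fun q => fderiv ℝ F q u) p v = fderiv ℝ (fun q => fderiv ℝ F q v) p u := by
  have hd : DifferentiableAt ℝ (fderiv ℝ F) p :=
    ((hF.fderiv_right (m := (⊤ : ℕ∞)) (by simp)).differentiable (by simp)) p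
  have hs := (hF.contDiffAt (x := p)).isSymmSndFDerivAt
    (by simpa using WithTop.coe_le_coe.2 (le_top (a := (2 : ℕ∞))))
  rw [fderiv_clm_apply hd (by fun_prop), fderiv_clm_apply hd (by fun_prop)]
  simpa using hs.eq v u

lemma contDiff_fderiv_apply {F : ℝ × ℝ → ℝ} (hF : ContDiff ℝ (⊤ : ℕ∞) F) (u : ℝ × ℝ) :
    ContDiff ℝ (⊤ : ℕ∞) (fun q => fderiv ℝ F q u) :=
  (hF.fderiv_right (m := (⊤ : ℕ∞)) (by simp)).clm_apply contDiff_const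

/-- The parameter bounds available at each point, in terms of `X = s w`, `Z = ε X`,
`m = ∂ₜβ / β`, `K = s ∂ₜα` and `J = s ∂ₜ²α`. -/
structure CarlBounds (ε a X Z m K J : ℝ) : Prop where
  eps_pos : 0 < ε
  eps_lt : ε < 1
  Z_eq : Z = ε * X
  Z_ge : 1000 ≤ Z
  m_le : |m| ≤ Z / 1000
  K_le : |K| ≤ Z * X / 100
  a_nonneg : 0 ≤ a
  a_le : a ≤ Z * X / 1000
  J_nonneg : 0 ≤ J
  J_le : J ≤ Z ^ 2 * X / 100

namespace CarlBounds

variable {ε a X Z m K J : ℝ} (h : CarlBounds ε a X Z m K J)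
include h

lemma X_ge : Z ≤ X := by
  have h1 := h.Z_ge
  have h2 := h.Z_eq
  have h3 := h.eps_pos
  have h4 := h.eps_lt
  have hX : 0 < X := by
    by_contra hX
    nlinarith
  nlinarith

lemma drift_le :
    (-2 * m * Z * X + J + m * X) + (2 * Z * X + m * X - X) * (1 - 2 * Z)
      + (Z * X + K - X - a) * (-2 * Z) ≤ -5 * (Z ^ 2 * X) := by
  have hZ := h.Z_ge
  have hXZ := h.X_ge
  have hX : 0 < X := by linarith
  obtain ⟨hm1, hm2⟩ := abs_le.1 h.m_le
  obtain ⟨hK1, hK2⟩ := abs_le.1 h.K_le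
  have ha := h.a_le
  have hJ := h.J_le
  have e1 : 0 ≤ (m + Z / 1000) * (Z * X) := by
    have : 0 ≤ m + Z / 1000 := by linarith
    positivity
  have e2 : 0 ≤ (Z / 1000 - m) * X := mul_nonneg (by linarith) hX.le
  have e3 : 0 ≤ (K + Z * X / 100) * Z := mul_nonneg (by linarith) (by linarith)
  have e4 : 0 ≤ (Z * X / 1000 - a) * Z := mul_nonneg (by linarith) (by linarith)
  have e5 : 0 ≤ (Z - 1000) * (Z * X) := mul_nonneg (by linarith) (by positivity)
  have e6 : 0 ≤ (Z - 1000) * X := mul_nonneg (by linarith) hX.le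
  nlinarith

lemma interior_le {f p L₁ L₂ S : ℝ} (hL : L₁ + L₂ = Z * f) (hS : S ≤ -5 * (Z ^ 2 * X)) :
    X⁻¹ * (L₂ - (1 - 2 * Z) * p + K * f) ^ 2 + Z ^ 2 * X * f ^ 2
      ≤ -6 * (2 * L₁ * L₂ - (2 * ε * Z * p ^ 2 - S * f ^ 2)) := by
  have hZ := h.Z_ge
  have hXZ := h.X_ge
  have hX : 0 < X := by linarith
  have hε := h.eps_pos
  have h1 : 2 * L₁ * L₂ ≤ Z ^ 2 * f ^ 2 - L₂ ^ 2 := by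
    have : (L₁ + L₂) ^ 2 = Z ^ 2 * f ^ 2 := by rw [hL]; ring
    nlinarith [sq_nonneg L₁]
  have h2 : (L₂ - (1 - 2 * Z) * p + K * f) ^ 2
      ≤ 3 * (L₂ ^ 2 + ((1 - 2 * Z) * p) ^ 2 + (K * f) ^ 2) := by
    nlinarith [sq_nonneg (L₂ + (1 - 2 * Z) * p), sq_nonneg (L₂ - K * f),
      sq_nonneg ((1 - 2 * Z) * p + K * f)]
  have h3 : ((1 - 2 * Z) * p) ^ 2 ≤ X * (4 * ε * Z * p ^ 2) := by
    have : (1 - 2 * Z) ^ 2 ≤ 4 * Z ^ 2 := by nlinarith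
    have e : X * (4 * ε * Z * p ^ 2) = 4 * Z ^ 2 * p ^ 2 := by
      linear_combination (-4 * Z * p ^ 2) * h.Z_eq
    rw [e, mul_pow]
    exact mul_le_mul_of_nonneg_right this (sq_nonneg p)
  have h4 : (K * f) ^ 2 ≤ X * (Z ^ 2 * X / 10000 * f ^ 2) := by
    have : K ^ 2 ≤ (Z * X / 100) ^ 2 := sq_le_sq' (abs_le.1 h.K_le).1 (abs_le.1 h.K_le).2
    calc (K * f) ^ 2 = K ^ 2 * f ^ 2 := by ring
      _ ≤ (Z * X / 100) ^ 2 * f ^ 2 := mul_le_mul_of_nonneg_right this (sq_nonneg f)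
      _ = _ := by ring
  have h5 : L₂ ^ 2 ≤ X * L₂ ^ 2 := le_mul_of_one_le_left (sq_nonneg _) (by linarith)
  have h6 : X⁻¹ * (L₂ - (1 - 2 * Z) * p + K * f) ^ 2
      ≤ 3 * L₂ ^ 2 + 12 * ε * Z * p ^ 2 + Z ^ 2 * X * f ^ 2 := by
    rw [inv_mul_le_iff₀ hX]
    have : 0 ≤ X * (Z ^ 2 * X * f ^ 2) := by positivity
    nlinarith
  have h7 : 0 ≤ (-5 * (Z ^ 2 * X) - S) * f ^ 2 := mul_nonneg (by linarith) (sq_nonneg f)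
  have h8 : Z ^ 2 * f ^ 2 ≤ Z ^ 2 * X * f ^ 2 / 1000 := by
    have : 0 ≤ (X - 1000) * (Z ^ 2 * f ^ 2) := mul_nonneg (by linarith) (by positivity)
    linarith
  have h9 : 0 ≤ Z ^ 2 * X * f ^ 2 := by positivity
  nlinarith [sq_nonneg L₂]

lemma left_boundary_le {f fx ft p q : ℝ} (hp : p = fx + X * f) (hq : q = ft - K * f)
    (hbc : ft + fx = 0) :
    Z ^ 2 * X * f ^ 2 + ε * Z * fx ^ 2
      ≤ -6 * (2 * ε * p * q + ε * (1 - 2 * Z) * p ^ 2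
        + (Z * X + K - X - a) * (1 - 2 * Z) * f ^ 2) := by
  have hZ := h.Z_ge
  have hXZ := h.X_ge
  have hX : 0 < X := by linarith
  have hε := h.eps_pos
  obtain ⟨hK1, hK2⟩ := abs_le.1 h.K_le
  have hfx : fx = p - X * f := by linarith
  have hq' : q = -p + (X - K) * f := by rw [hq, hp]; linear_combination hbc
  have h1 : ε * Z * fx ^ 2 ≤ 2 * (ε * Z * p ^ 2) + 2 * (Z ^ 2 * X * f ^ 2) := by
    have : ε * Z * fx ^ 2 ≤ ε * Z * (2 * p ^ 2 + 2 * X ^ 2 * f ^ 2) := by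
      refine mul_le_mul_of_nonneg_left ?_ (by positivity)
      rw [hfx]
      nlinarith [sq_nonneg (p + X * f)]
    have e : ε * Z * (2 * X ^ 2 * f ^ 2) = 2 * (Z ^ 2 * X * f ^ 2) := by
      linear_combination (-2 * Z * X * f ^ 2) * h.Z_eq
    linarith
  have h2 : 2 * ε * p * ((X - K) * f) ≤ (ε * Z * p ^ 2 + Z ^ 2 * X * f ^ 2) / 50 := by
    have hk : (X - K) ^ 2 ≤ (Z * X / 50) ^ 2 := by
      apply sq_le_sq' <;> nlinarith
    have e1 : 2 * ε * p * ((X - K) * f)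
        ≤ ε * Z * p ^ 2 / 50 + 50 * ε / Z * ((X - K) ^ 2 * f ^ 2) := by
      have e : ε * Z * p ^ 2 / 50 + 50 * ε / Z * ((X - K) ^ 2 * f ^ 2)
          - 2 * ε * p * ((X - K) * f) = ε * Z / 50 * (p - 50 / Z * ((X - K) * f)) ^ 2 := by
        have : Z ≠ 0 := by linarith
        field_simp
        ring
      have : 0 ≤ ε * Z / 50 * (p - 50 / Z * ((X - K) * f)) ^ 2 := by positivity
      linarith
    have e2 : 50 * ε / Z * ((X - K) ^ 2 * f ^ 2) ≤ 50 * ε / Z * ((Z * X / 50) ^ 2 * f ^ 2) := by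
      gcongr
    have e3 : 50 * ε / Z * ((Z * X / 50) ^ 2 * f ^ 2) = Z ^ 2 * X * f ^ 2 / 50 := by
      have : Z ≠ 0 := by linarith
      field_simp
      linear_combination (-f ^ 2) * h.Z_eq
    linarith
  have h3 : (Z * X + K - X - a) * (1 - 2 * Z) * f ^ 2 ≤ -(Z ^ 2 * X) * f ^ 2 := by
    refine mul_le_mul_of_nonneg_right ?_ (sq_nonneg f)
    have ha := h.a_le
    have hA : Z * X * (9 / 10) ≤ Z * X + K - X - a := by nlinarith
    nlinarith [mul_nonneg (sub_nonneg.2 hA) (by linarith : 0 ≤ 2 * Z - 1),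
      mul_nonneg (sub_nonneg.2 hZ) (by positivity : 0 ≤ Z * X)]
  rw [hq']
  have h4 : 0 ≤ ε * Z * p ^ 2 := by positivity
  have h5 : 0 ≤ Z ^ 2 * X * f ^ 2 := by positivity
  have h6 : 0 ≤ ε * p ^ 2 := by positivity
  nlinarith

lemma right_boundary_le {f fx ft p q Y : ℝ} (hp : p = fx + X * f) (hq : q = ft - K * f)
    (hbc : ε * (ft - fx) - f = 0) (hK : ε * Z * K ^ 2 ≤ Y) :
    Z ^ 2 * X * f ^ 2
      - 6 * (2 * ε * p * q + ε * (1 - 2 * Z) * p ^ 2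
        + (Z * X + K - X - a) * (1 - 2 * Z) * f ^ 2)
      ≤ 100 * ((Z ^ 2 * X + Y) * f ^ 2 + ε * Z * ft ^ 2) := by
  have hZ := h.Z_ge
  have hXZ := h.X_ge
  have hX : 0 < X := by linarith
  have hε := h.eps_pos
  have hp' : ε * p = ε * ft + (Z - 1) * f := by
    rw [hp, h.Z_eq]; linear_combination -hbc
  have h1 : ε * Z * p ^ 2 ≤ 2 * (ε * Z * ft ^ 2) + 2 * (Z ^ 2 * X * f ^ 2) := by
    have e1 : (ε * p) ^ 2 ≤ 2 * (ε * ft) ^ 2 + 2 * (Z ^ 2 * f ^ 2) := by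
      have : (Z - 1) ^ 2 * f ^ 2 ≤ Z ^ 2 * f ^ 2 := by
        gcongr
        · linarith
        · linarith
      rw [hp']
      nlinarith [sq_nonneg (ε * ft - (Z - 1) * f)]
    have e2 : ε * (ε * Z * p ^ 2) ≤ ε * (2 * (ε * Z * ft ^ 2) + 2 * (Z ^ 2 * X * f ^ 2)) := by
      have e3 : ε * (2 * (ε * Z * ft ^ 2) + 2 * (Z ^ 2 * X * f ^ 2))
          = Z * (2 * (ε * ft) ^ 2 + 2 * (Z ^ 2 * f ^ 2)) := by
        linear_combination (-2 * Z ^ 2 * f ^ 2) * h.Z_eq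
      rw [e3, show ε * (ε * Z * p ^ 2) = Z * (ε * p) ^ 2 by ring]
      gcongr
    exact le_of_mul_le_mul_left e2 hε
  have h2 : ε * Z * q ^ 2 ≤ 2 * (ε * Z * ft ^ 2) + 2 * (Y * f ^ 2) := by
    have e1 : ε * Z * q ^ 2 ≤ ε * Z * (2 * ft ^ 2 + 2 * (K ^ 2 * f ^ 2)) := by
      gcongr
      rw [hq]
      nlinarith [sq_nonneg (ft + K * f)]
    have e2 : ε * Z * K ^ 2 * f ^ 2 ≤ Y * f ^ 2 := mul_le_mul_of_nonneg_right hK (sq_nonneg f)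
    linarith
  have h3 : ε * q ^ 2 ≤ ε * Z * q ^ 2 := by
    gcongr
    nlinarith
  have h4 : -(2 * ε * p * q) ≤ ε * p ^ 2 + ε * q ^ 2 := by
    have : 0 ≤ ε * (p + q) ^ 2 := by positivity
    linarith
  have h5 : -((Z * X + K - X - a) * (1 - 2 * Z)) ≤ 3 * (Z ^ 2 * X) := by
    have hK := (abs_le.1 h.K_le).2
    have ha := h.a_nonneg
    have hA : Z * X + K - X - a ≤ Z * X * (3 / 2) := by nlinarith
    have hA' : 0 ≤ Z * X * (3 / 2) := by positivity
    nlinarith [mul_nonneg (sub_nonneg.2 hA) (by linarith : 0 ≤ 2 * Z - 1)]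
  have h6 : -((Z * X + K - X - a) * (1 - 2 * Z)) * f ^ 2 ≤ 3 * (Z ^ 2 * X) * f ^ 2 :=
    mul_le_mul_of_nonneg_right h5 (sq_nonneg f)
  have h7 : 0 ≤ ε * Z * ft ^ 2 := by positivity
  have h8 : 0 ≤ Z ^ 2 * X * f ^ 2 := by positivity
  have h9 : 0 ≤ Y * f ^ 2 := by
    have : 0 ≤ ε * Z * K ^ 2 := by positivity
    have : 0 ≤ Y := this.trans hK
    positivity
  linarith

end CarlBounds

lemma carlW_pos {T t : ℝ} (ht : t ∈ Ioo 0 T) (x : ℝ) : 0 < carlW T t x :=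
  div_pos (exp_pos _) (mul_pos ht.1 (sub_pos.2 ht.2))

lemma inv_time_le_carlW {T t x : ℝ} (ht : t ∈ Ioo 0 T) (hx : -1 ≤ x) :
    (t * (T - t))⁻¹ ≤ carlW T t x := by
  have hβ : 0 < t * (T - t) := mul_pos ht.1 (sub_pos.2 ht.2)
  rw [carlW, inv_eq_one_div]
  gcongr
  exact one_le_exp (by linarith)

lemma carlA_nonneg {T t x : ℝ} (ht : t ∈ Ioo 0 T) (hx : x < 1) : 0 ≤ carlA T t x :=
  (div_pos (exp_three_sub_pos hx) (mul_pos ht.1 (sub_pos.2 ht.2))).le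

lemma exp_le_mul_exp {x y c : ℝ} {n : ℕ} (hxy : x ≤ y + n) (hc : 2.7182818286 ^ n ≤ c) :
    exp x ≤ c * exp y := by
  calc exp x ≤ exp (y + n) := exp_le_exp.2 hxy
    _ = exp 1 ^ n * exp y := by rw [exp_add, mul_comm, ← exp_nat_mul, mul_one]
    _ ≤ c * exp y := by
      gcongr
      exact (pow_le_pow_left₀ (exp_pos 1).le exp_one_lt_d9.le n).trans hc

lemma carlA_le {T t x : ℝ} (ht : t ∈ Ioo 0 T) (hx : -1 ≤ x) :
    carlA T t x ≤ 7 * carlW T t x := by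
  have hβ : 0 < t * (T - t) := mul_pos ht.1 (sub_pos.2 ht.2)
  rw [carlA, carlW, ← mul_div_assoc]
  gcongr
  have := exp_le_mul_exp (x := 3) (y := 2 + x) (c := 8) (n := 2) (by norm_num; linarith)
    (by norm_num)
  linarith

lemma carlA_zero_le {T t : ℝ} (ht : t ∈ Ioo 0 T) : carlA T t 0 ≤ 2 * carlW T t 0 := by
  have hβ : 0 < t * (T - t) := mul_pos ht.1 (sub_pos.2 ht.2)
  rw [carlA, carlW, ← mul_div_assoc]
  gcongr
  have := exp_le_mul_exp (x := 3) (y := 2 + 0) (c := 3) (n := 1) (by norm_num) (by norm_num)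
  linarith

lemma abs_carlM_le {T t : ℝ} (ht : t ∈ Ioo 0 T) : |carlM T t| ≤ T * (t * (T - t))⁻¹ := by
  have hβ : 0 < t * (T - t) := mul_pos ht.1 (sub_pos.2 ht.2)
  rw [carlM, abs_div, abs_of_pos hβ, div_eq_mul_inv]
  gcongr
  rw [abs_le]
  constructor <;> linarith [ht.1, ht.2]

lemma four_le_sq_mul_inv_time {T t : ℝ} (ht : t ∈ Ioo 0 T) :
    4 ≤ T ^ 2 * (t * (T - t))⁻¹ := by
  have hβ : 0 < t * (T - t) := mul_pos ht.1 (sub_pos.2 ht.2)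
  rw [← div_eq_mul_inv, le_div_iff₀ hβ]
  nlinarith [sq_nonneg (T - 2 * t)]

/-- The second time derivative of `carlA` is a nonnegative multiple of `carlA`. -/
def carlAtt (T t x : ℝ) : ℝ :=
  (2 * (t * (T - t))⁻¹ + 2 * carlM T t ^ 2) * carlA T t x

lemma carlBounds_of_le {T a ε s t x : ℝ} (hT : 0 < T) (ha : 0 ≤ a) (hε : ε ∈ Ioo (0 : ℝ) 1)
    (hs : 1000 * ((T + T ^ 2) / ε + √a * T ^ 2 / √ε) ≤ s)
    (ht : t ∈ Ioo 0 T) (hx : x ∈ Icc (-1 : ℝ) 0) :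
    CarlBounds ε a (s * carlW T t x) (ε * (s * carlW T t x)) (carlM T t)
      (s * -(carlM T t * carlA T t x)) (s * carlAtt T t x) := by
  obtain ⟨hε0, hε1⟩ := hε
  have hβ : 0 < t * (T - t) := mul_pos ht.1 (sub_pos.2 ht.2)
  have hr : 0 < (t * (T - t))⁻¹ := inv_pos.2 hβ
  have hrw := inv_time_le_carlW ht hx.1
  have h4 := four_le_sq_mul_inv_time ht
  have hm := abs_carlM_le ht
  have hA0 := carlA_nonneg ht (by linarith [hx.2] : x < 1)
  have hA := carlA_le ht hx.1
  have hw := carlW_pos ht x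
  unfold carlAtt
  set r := (t * (T - t))⁻¹
  set w := carlW T t x
  set α := carlA T t x
  set m := carlM T t
  have hsε : 0 < √ε := sqrt_pos.2 hε0
  have hs1 : 1000 * (T + T ^ 2) ≤ ε * s := by
    have : 1000 * ((T + T ^ 2) / ε) ≤ s := by
      have : 0 ≤ √a * T ^ 2 / √ε := by positivity
      linarith
    rw [← mul_div_assoc, div_le_iff₀ hε0] at this
    linarith
  have hs0 : 0 < s := by
    have : 0 < ε * s := lt_of_lt_of_le (by positivity) hs1
    exact pos_of_mul_pos_right this hε0.le
  have hs2 : 1000 ^ 2 * (a * T ^ 4) ≤ ε * s ^ 2 := by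
    have h1 : 1000 * (√a * T ^ 2 / √ε) ≤ s := by
      have : 0 ≤ (T + T ^ 2) / ε := by positivity
      linarith
    rw [← mul_div_assoc, div_le_iff₀ hsε] at h1
    have h2 := pow_le_pow_left₀ (by positivity) h1 2
    rw [mul_pow, mul_pow, mul_pow, sq_sqrt ha, sq_sqrt hε0.le] at h2
    linarith
  have hZr : ε * s * r ≤ ε * (s * w) := by
    rw [mul_assoc]
    gcongr
  have hTr : 1000 * (T * r) ≤ ε * (s * w) := by
    have : 1000 * (T + T ^ 2) * r ≤ ε * s * r := by gcongr
    nlinarith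
  have hmZ : |m| ≤ ε * (s * w) / 1000 := by linarith
  have hX : 0 < s * w := by positivity
  refine ⟨hε0, hε1, rfl, ?_, hmZ, ?_, ha, ?_, by positivity, ?_⟩
  · have : 1000 * (T + T ^ 2) * r ≤ ε * s * r := by gcongr
    have : 0 < T * r := by positivity
    nlinarith
  · rw [abs_mul, abs_neg, abs_mul, abs_of_pos hs0, abs_of_nonneg hA0]
    calc s * (|m| * α) ≤ s * (ε * (s * w) / 1000 * (7 * w)) := by gcongr
      _ = 7 / 1000 * (ε * (s * w) * (s * w)) := by ring
      _ ≤ _ := by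
        have : 0 ≤ ε * (s * w) * (s * w) := by positivity
        linarith
  · have h16 : 1 ≤ (T ^ 2 * r) ^ 2 := one_le_pow₀ (by linarith)
    calc a ≤ a * (T ^ 2 * r) ^ 2 := le_mul_of_one_le_right ha h16
      _ = (1000 ^ 2 * (a * T ^ 4)) * r ^ 2 / 1000 ^ 2 := by ring
      _ ≤ (ε * s ^ 2) * w ^ 2 / 1000 ^ 2 := by gcongr
      _ ≤ _ := by
        have : 0 ≤ ε * (s * w) * (s * w) := by positivity
        linarith
  · have h1 : 2 * r ≤ (ε * (s * w) / 1000) ^ 2 := by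
      calc 2 * r ≤ (T ^ 2 * r) * r := by gcongr; linarith
        _ = (T * r) ^ 2 := by ring
        _ ≤ _ := by gcongr; linarith
    have h2 : m ^ 2 ≤ (ε * (s * w) / 1000) ^ 2 := by
      rw [← sq_abs m]
      gcongr
    calc s * ((2 * r + 2 * m ^ 2) * α)
        ≤ s * ((3 * (ε * (s * w) / 1000) ^ 2) * (7 * w)) := by
          gcongr
          linarith
      _ = 21 / 1000 ^ 2 * ((ε * (s * w)) ^ 2 * (s * w)) := by ring
      _ ≤ _ := by
        have : 0 ≤ (ε * (s * w)) ^ 2 * (s * w) := by positivity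
        linarith

lemma carlK_zero_sq_le {T ε s t : ℝ} (hT : 0 < T) (hε : 0 < ε) (hs : 0 < s)
    (ht : t ∈ Ioo 0 T) :
    ε * (ε * (s * carlW T t 0)) * (s * -(carlM T t * carlA T t 0)) ^ 2
      ≤ ε ^ 2 * s ^ 3 * (T ^ 2 * carlW T t 0 ^ 5) := by
  have hw := carlW_pos ht 0
  have hA0 := carlA_nonneg ht one_pos
  have hA := carlA_zero_le ht
  have hm : |carlM T t| ≤ T * (carlW T t 0 / 2) := by
    have hβ : 0 < t * (T - t) := mul_pos ht.1 (sub_pos.2 ht.2)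
    refine (abs_carlM_le ht).trans (mul_le_mul_of_nonneg_left ?_ hT.le)
    rw [inv_eq_one_div, carlW, div_right_comm]
    gcongr
    rw [one_le_div two_pos]
    exact le_trans (by norm_num) (add_one_le_exp ((2 : ℝ) + 0))
  have h : (carlM T t * carlA T t 0) ^ 2 ≤ (T * carlW T t 0 ^ 2) ^ 2 := by
    rw [← sq_abs, abs_mul, abs_of_nonneg hA0]
    refine pow_le_pow_left₀ (by positivity) ?_ 2
    calc |carlM T t| * carlA T t 0 ≤ T * (carlW T t 0 / 2) * (2 * carlW T t 0) := by gcongr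
      _ = _ := by ring
  calc ε * (ε * (s * carlW T t 0)) * (s * -(carlM T t * carlA T t 0)) ^ 2
      = ε ^ 2 * s ^ 3 * carlW T t 0 * (carlM T t * carlA T t 0) ^ 2 := by ring
    _ ≤ ε ^ 2 * s ^ 3 * carlW T t 0 * (T * carlW T t 0 ^ 2) ^ 2 := by gcongr
    _ = _ := by ring

section Derivatives

variable {T t x : ℝ}

lemma hasDerivAt_exp_two_add : HasDerivAt (fun y => exp (2 + y)) (exp (2 + x)) x := by
  simpa using ((hasDerivAt_id x).const_add 2).exp

lemma hasDerivAt_carlW_space : HasDerivAt (fun y => carlW T t y) (carlW T t x) x :=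
  hasDerivAt_exp_two_add.div_const _

lemma hasDerivAt_carlA_space : HasDerivAt (fun y => carlA T t y) (-carlW T t x) x := by
  have h := (hasDerivAt_exp_two_add (x := x)).const_sub (exp 3) |>.div_const (t * (T - t))
  rwa [neg_div] at h

lemma hasDerivAt_time_mul : HasDerivAt (fun τ => τ * (T - τ)) (T - 2 * t) t := by
  refine ((hasDerivAt_id t).mul ((hasDerivAt_id t).const_sub T)).congr_deriv ?_
  simp only [id]
  ring

lemma hasDerivAt_const_div_time (ht : t ∈ Ioo 0 T) (c : ℝ) :
    HasDerivAt (fun τ => c / (τ * (T - τ))) (-(carlM T t * (c / (t * (T - t))))) t := by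
  have hβ : t * (T - t) ≠ 0 := (mul_pos ht.1 (sub_pos.2 ht.2)).ne'
  refine ((hasDerivAt_const t c).div hasDerivAt_time_mul hβ).congr_deriv ?_
  rw [carlM]
  field_simp
  ring

lemma hasDerivAt_carlW_time (ht : t ∈ Ioo 0 T) :
    HasDerivAt (fun τ => carlW T τ x) (-(carlM T t * carlW T t x)) t :=
  hasDerivAt_const_div_time ht _

lemma hasDerivAt_carlA_time (ht : t ∈ Ioo 0 T) :
    HasDerivAt (fun τ => carlA T τ x) (-(carlM T t * carlA T t x)) t :=
  hasDerivAt_const_div_time ht _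

lemma hasDerivAt_carlM (ht : t ∈ Ioo 0 T) :
    HasDerivAt (fun τ => carlM T τ) (-(2 * (t * (T - t))⁻¹ + carlM T t ^ 2)) t := by
  have hβ : t * (T - t) ≠ 0 := (mul_pos ht.1 (sub_pos.2 ht.2)).ne'
  refine ((((hasDerivAt_id t).const_mul 2).const_sub T).div
    hasDerivAt_time_mul hβ).congr_deriv ?_
  simp only [carlM, id]
  field_simp
  ring

lemma hasDerivAt_carlE_space {σ : ℝ} (hσ : 0 < σ) (ht : t ∈ Ioo 0 T) (hx : x < 1) :
    HasDerivAt (fun y => carlE T σ (t, y)) (σ * carlW T t x * carlE T σ (t, x)) x := by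
  have h := ((hasDerivAt_carlA_space (T := T) (t := t) (x := x)).const_mul (-σ)).exp
  rw [carlE_eq_exp hσ ht hx]
  refine (h.congr_of_eventuallyEq ?_).congr_deriv (by ring)
  filter_upwards [isOpen_Iio.mem_nhds hx] with y hy
  exact carlE_eq_exp hσ ht hy

lemma hasDerivAt_carlE_time {σ : ℝ} (hσ : 0 < σ) (ht : t ∈ Ioo 0 T) (hx : x < 1) :
    HasDerivAt (fun τ => carlE T σ (τ, x))
      (σ * (carlM T t * carlA T t x) * carlE T σ (t, x)) t := by
  have h := ((hasDerivAt_carlA_time (x := x) ht).const_mul (-σ)).exp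
  rw [carlE_eq_exp hσ ht hx]
  refine (h.congr_of_eventuallyEq ?_).congr_deriv (by ring)
  filter_upwards [isOpen_Ioo.mem_nhds ht] with y hy
  exact carlE_eq_exp hσ hy hx

end Derivatives

/-- The zeroth-order coefficient of the symmetric part of the conjugated operator. -/
def conjPotential (T ε a s : ℝ) (p : ℝ × ℝ) : ℝ :=
  ε * (s * carlW T p.1 p.2) * (s * carlW T p.1 p.2)
    + s * -(carlM T p.1 * carlA T p.1 p.2) - s * carlW T p.1 p.2 - a

/-- The transport coefficient of the conjugated operator. -/
def conjDrift (T ε s : ℝ) (p : ℝ × ℝ) : ℝ := 1 - 2 * (ε * (s * carlW T p.1 p.2))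

/-- `e^{-sα} conjX = ∂ₓ (e^{-sα} f)`. -/
def conjX (T s : ℝ) (f fx : ℝ × ℝ → ℝ) (p : ℝ × ℝ) : ℝ :=
  fx p + s * carlW T p.1 p.2 * f p

/-- `e^{-sα} conjT = ∂ₜ (e^{-sα} f)`. -/
def conjT (T s : ℝ) (f ft : ℝ × ℝ → ℝ) (p : ℝ × ℝ) : ℝ :=
  ft p - s * -(carlM T p.1 * carlA T p.1 p.2) * f p

/-- The unweighted time flux of the Carleman identity. -/
def carlFluxT (T ε a s : ℝ) (f fx : ℝ × ℝ → ℝ) (p : ℝ × ℝ) : ℝ :=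
  conjPotential T ε a s p * f p ^ 2 - ε * conjX T s f fx p ^ 2

/-- The unweighted space flux of the Carleman identity. -/
def carlFluxX (T ε a s : ℝ) (f fx ft : ℝ × ℝ → ℝ) (p : ℝ × ℝ) : ℝ :=
  2 * ε * conjX T s f fx p * conjT T s f ft p
    + ε * conjDrift T ε s p * conjX T s f fx p ^ 2
    + conjPotential T ε a s p * conjDrift T ε s p * f p ^ 2

lemma carlFluxT_tame {T ε a s : ℝ} {f fx : ℝ × ℝ → ℝ} (hf : ContDiff ℝ 1 f)
    (hfx : ContDiff ℝ 1 fx) : CarlTame T (carlFluxT T ε a s f fx) := by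
  have hf := CarlTame.of_contDiff (T := T) hf
  have hfx := CarlTame.of_contDiff (T := T) hfx
  unfold carlFluxT conjPotential conjX
  repeat' first
    | exact hf | exact hfx | exact CarlTame.const _ | exact CarlTame.carlW
    | exact CarlTame.carlA | exact CarlTame.carlM | apply CarlTame.pow | apply CarlTame.sub
    | apply CarlTame.neg | apply CarlTame.add | apply CarlTame.mul

lemma carlFluxX_tame {T ε a s : ℝ} {f fx ft : ℝ × ℝ → ℝ} (hf : ContDiff ℝ 1 f)
    (hfx : ContDiff ℝ 1 fx) (hft : ContDiff ℝ 1 ft) :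
    CarlTame T (carlFluxX T ε a s f fx ft) := by
  have hf := CarlTame.of_contDiff (T := T) hf
  have hfx := CarlTame.of_contDiff (T := T) hfx
  have hft := CarlTame.of_contDiff (T := T) hft
  unfold carlFluxX conjPotential conjDrift conjX conjT
  repeat' first
    | exact hf | exact hfx | exact hft | exact CarlTame.const _ | exact CarlTame.carlW
    | exact CarlTame.carlA | exact CarlTame.carlM | apply CarlTame.pow | apply CarlTame.sub
    | apply CarlTame.neg | apply CarlTame.add | apply CarlTame.mul

lemma carlFlux_divergence {T ε a s t x fxx fxt : ℝ} {f fx ft : ℝ × ℝ → ℝ} (hs : 0 < s)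
    (ht : t ∈ Ioo 0 T) (hx : x < 1)
    (hT : DifferentiableAt ℝ (fun p => carlE T (2 * s) p * carlFluxT T ε a s f fx p) (t, x))
    (hX : DifferentiableAt ℝ (fun p => carlE T (2 * s) p * carlFluxX T ε a s f fx ft p) (t, x))
    (hfx : HasDerivAt (fun y => f (t, y)) (fx (t, x)) x)
    (hfxx : HasDerivAt (fun y => fx (t, y)) fxx x)
    (hftx : HasDerivAt (fun y => ft (t, y)) fxt x)
    (hft : HasDerivAt (fun τ => f (τ, x)) (ft (t, x)) t)
    (hfxt : HasDerivAt (fun τ => fx (τ, x)) fxt t) :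
    fderiv ℝ (fun p => carlE T (2 * s) p * carlFluxT T ε a s f fx p) (t, x) (1, 0)
      + fderiv ℝ (fun p => carlE T (2 * s) p * carlFluxX T ε a s f fx ft p) (t, x) (0, 1)
    = carlE T (2 * s) (t, x) *
      (2 * (ε * (fxx + 2 * (s * carlW T t x) * fx (t, x)
            + ((s * carlW T t x) ^ 2 + s * carlW T t x) * f (t, x))
          + conjPotential T ε a s (t, x) * f (t, x))
        * (conjT T s f ft (t, x) + conjDrift T ε s (t, x) * conjX T s f fx (t, x))
      - (2 * ε * (ε * (s * carlW T t x)) * conjX T s f fx (t, x) ^ 2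
        - ((-2 * carlM T t * (ε * (s * carlW T t x)) * (s * carlW T t x) + s * carlAtt T t x
            + carlM T t * (s * carlW T t x))
          + (2 * (ε * (s * carlW T t x)) * (s * carlW T t x) + carlM T t * (s * carlW T t x)
            - s * carlW T t x) * (1 - 2 * (ε * (s * carlW T t x)))
          + (ε * (s * carlW T t x) * (s * carlW T t x) + s * -(carlM T t * carlA T t x)
            - s * carlW T t x - a) * (-2 * (ε * (s * carlW T t x)))) * f (t, x) ^ 2)) := by
  have hs2 : 0 < 2 * s := by positivity
  have hXw := (hasDerivAt_carlW_space (T := T) (t := t) (x := x)).const_mul s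
  have hXA := ((((hXw.const_mul ε).mul hXw).add
    ((((hasDerivAt_carlA_space (T := T) (t := t) (x := x)).const_mul
      (carlM T t)).neg).const_mul s)).sub hXw).sub_const a
  have hXB := ((hXw.const_mul ε).const_mul 2).const_sub 1
  have hXp := hfxx.add (hXw.mul hfx)
  have hXq := hftx.sub (((((hasDerivAt_carlA_space (T := T) (t := t) (x := x)).const_mul
      (carlM T t)).neg).const_mul s).mul hfx)
  have hXflux := (hasDerivAt_carlE_space hs2 ht hx).mul
    ((((hXp.const_mul (2 * ε)).mul hXq).add ((hXB.const_mul ε).mul (hXp.pow 2))).add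
      ((hXA.mul hXB).mul (hfx.pow 2)))
  have hTw := (hasDerivAt_carlW_time (x := x) ht).const_mul s
  have hTA := ((((hTw.const_mul ε).mul hTw).add
    ((((hasDerivAt_carlM ht).mul (hasDerivAt_carlA_time (x := x) ht)).neg).const_mul
      s)).sub hTw).sub_const a
  have hTp := hfxt.add (hTw.mul hft)
  have hTflux := (hasDerivAt_carlE_time hs2 ht hx).mul
    ((hTA.mul (hft.pow 2)).sub ((hTp.pow 2).const_mul ε))
  rw [(hasDerivAt_fst_of_differentiableAt hT).unique hTflux,
    (hasDerivAt_snd_of_differentiableAt hX).unique hXflux]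
  simp only [conjPotential, conjDrift, conjX, conjT, carlAtt, Pi.add_apply, Pi.mul_apply,
    Pi.sub_apply, Pi.pow_apply, Pi.neg_apply]
  push_cast
  ring

section RectangleIntegrals

variable {T : ℝ} {F G : ℝ × ℝ → ℝ}

lemma integrableOn_rectangle (hF : ContinuousOn F {p | p.2 < 1}) :
    IntegrableOn F (Icc 0 T ×ˢ Icc (-1) 0) :=
  (hF.mono fun _ hp => lt_of_le_of_lt hp.2.2 one_pos).integrableOn_compact
    (isCompact_Icc.prod isCompact_Icc)

lemma integral_integral_eq_setIntegral (hT : 0 < T) (hF : ContinuousOn F {p | p.2 < 1}) :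
    (∫ t in (0 : ℝ)..T, ∫ x in (-1 : ℝ)..0, F (t, x)) = ∫ p in Ioo 0 T ×ˢ Ioo (-1) 0, F p := by
  have h : IntegrableOn F (Ioo 0 T ×ˢ Ioo (-1) 0) :=
    (integrableOn_rectangle hF).mono_set (prod_mono Ioo_subset_Icc_self Ioo_subset_Icc_self)
  rw [Measure.volume_eq_prod, setIntegral_prod _ h]
  simp only [intervalIntegral.integral_of_le hT.le,
    intervalIntegral.integral_of_le (by norm_num : (-1 : ℝ) ≤ 0), integral_Ioc_eq_integral_Ioo]

lemma integral_integral_congr (hT : 0 < T) {u v : ℝ → ℝ → ℝ}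
    (h : ∀ t ∈ Ioo 0 T, ∀ x ∈ Ioo (-1 : ℝ) 0, u t x = v t x) :
    (∫ t in (0 : ℝ)..T, ∫ x in (-1 : ℝ)..0, u t x)
      = ∫ t in (0 : ℝ)..T, ∫ x in (-1 : ℝ)..0, v t x :=
  intervalIntegral.integral_congr_Ioo_of_le hT.le fun t ht =>
    intervalIntegral.integral_congr_Ioo_of_le (by norm_num) fun x hx => h t ht x hx

lemma intervalIntegrable_trace (hF : ContinuousOn F {p | p.2 < 1}) {x : ℝ} (hx : x < 1) :
    IntervalIntegrable (fun t => F (t, x)) volume 0 T := by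
  refine Continuous.intervalIntegrable ?_ 0 T
  exact hF.comp_continuous (by fun_prop) fun t => hx

/-- The divergence theorem on `(0, T) × (-1, 0)` for weighted fluxes vanishing at `t = 0, T`. -/
lemma integral_divergence_carlE {σ : ℝ} (hT : 0 < T) (hσ : 0 < σ)
    (hF : CarlTame T F) (hG : CarlTame T G) :
    ContinuousOn (fun p => fderiv ℝ (fun p => carlE T σ p * F p) p (1, 0)
        + fderiv ℝ (fun p => carlE T σ p * G p) p (0, 1)) {p | p.2 < 1} ∧
    (∫ t in (0 : ℝ)..T, ∫ x in (-1 : ℝ)..0,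
      fderiv ℝ (fun p => carlE T σ p * F p) (t, x) (1, 0)
        + fderiv ℝ (fun p => carlE T σ p * G p) (t, x) (0, 1))
      = (∫ t in (0 : ℝ)..T, carlE T σ (t, 0) * G (t, 0))
        - ∫ t in (0 : ℝ)..T, carlE T σ (t, -1) * G (t, -1) := by
  have hd : ∀ {H : ℝ × ℝ → ℝ}, CarlTame T H →
      ContinuousOn (fderiv ℝ (fun p => carlE T σ p * H p)) {p | p.2 < 1} := fun hH p hp =>
    ((hH σ hσ p hp).fderiv_right (m := 0) (by simp)).continuousAt.continuousWithinAt
  have hc := ((hd hF).clm_apply (continuousOn_const (c := ((1 : ℝ), (0 : ℝ))))).add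
    ((hd hG).clm_apply (continuousOn_const (c := ((0 : ℝ), (1 : ℝ)))))
  refine ⟨hc, ?_⟩
  have hsub : uIcc 0 T ×ˢ uIcc (-1 : ℝ) 0 ⊆ {p : ℝ × ℝ | p.2 < 1} := by
    rintro p ⟨-, hp⟩
    rw [uIcc_of_le (by norm_num)] at hp
    exact lt_of_le_of_lt hp.2 one_pos
  have hsub' : Ioo (min 0 T) (max 0 T) ×ˢ Ioo (min (-1 : ℝ) 0) (max (-1) 0)
      ⊆ {p : ℝ × ℝ | p.2 < 1} := by
    rintro p ⟨-, hp⟩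
    exact hp.2.trans (by norm_num)
  rw [integral2_divergence_prod_of_hasFDerivAt (fun p => carlE T σ p * F p)
    (fun p => carlE T σ p * G p) _ _ 0 (-1) T 0 ((hF.continuousOn hσ).mono hsub)
    ((hG.continuousOn hσ).mono hsub)
    (fun p hp => ((hF σ hσ p (hsub' hp)).differentiableAt one_ne_zero).hasFDerivAt)
    (fun p hp => ((hG σ hσ p (hsub' hp)).differentiableAt one_ne_zero).hasFDerivAt)]
  · simp [carlE_of_time_eq_zero]
  · rw [uIcc_of_le hT.le, uIcc_of_le (by norm_num : (-1 : ℝ) ≤ 0)]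
    exact integrableOn_rectangle hc

end RectangleIntegrals

/-- A solution together with its derivatives as smooth functions on the plane. -/
lemma IsAdjSol1D.exists_derivatives {T ε a : ℝ} {φ : ℝ → ℝ → ℝ} (h : IsAdjSol1D T ε a φ) :
    ∃ f fx ft fxx fxt : ℝ × ℝ → ℝ, ContDiff ℝ 1 f ∧ ContDiff ℝ 1 fx ∧ ContDiff ℝ 1 ft ∧
      (∀ t x, φ t x = f (t, x)) ∧
      (∀ t x, HasDerivAt (fun y => f (t, y)) (fx (t, x)) x) ∧
      (∀ t x, HasDerivAt (fun τ => f (τ, x)) (ft (t, x)) t) ∧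
      (∀ t x, HasDerivAt (fun y => fx (t, y)) (fxx (t, x)) x) ∧
      (∀ t x, HasDerivAt (fun τ => fx (τ, x)) (fxt (t, x)) t) ∧
      (∀ t x, HasDerivAt (fun y => ft (t, y)) (fxt (t, x)) x) ∧
      (∀ t ∈ Ioo 0 T, ∀ x ∈ Ioo (-1 : ℝ) 0,
        ft (t, x) + fx (t, x) + ε * fxx (t, x) - a * f (t, x) = 0) ∧
      (∀ t ∈ Ioo 0 T, ε * (ft (t, 0) - fx (t, 0)) - f (t, 0) = 0) ∧
      (∀ t ∈ Ioo 0 T, ft (t, -1) + fx (t, -1) = 0) := by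
  obtain ⟨hφ, hpde, hbc0, hbc1⟩ := h
  set f : ℝ × ℝ → ℝ := fun p => φ p.1 p.2 with hf
  have hX := contDiff_fderiv_apply hφ (0, 1)
  have hT := contDiff_fderiv_apply hφ (1, 0)
  have hdf := hφ.differentiable (by simp)
  have hdX := hX.differentiable (by simp)
  have hdT := hT.differentiable (by simp)
  have h1 : ∀ t x, HasDerivAt (fun y => f (t, y)) (fderiv ℝ f (t, x) (0, 1)) x :=
    fun t x => hasDerivAt_snd_of_differentiableAt (hdf (t, x))
  have h2 : ∀ t x, HasDerivAt (fun τ => f (τ, x)) (fderiv ℝ f (t, x) (1, 0)) t :=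
    fun t x => hasDerivAt_fst_of_differentiableAt (hdf (t, x))
  have h3 := fun t x => hasDerivAt_snd_of_differentiableAt (hdX (t, x))
  have h1' : ∀ t x, deriv (fun y => φ t y) x = fderiv ℝ f (t, x) (0, 1) :=
    fun t x => (h1 t x).deriv
  have h2' : ∀ t x, deriv (fun τ => φ τ x) t = fderiv ℝ f (t, x) (1, 0) :=
    fun t x => (h2 t x).deriv
  have h3' : ∀ t x, deriv (deriv (fun y => φ t y)) x
      = fderiv ℝ (fun q => fderiv ℝ f q (0, 1)) (t, x) (0, 1) := fun t x => by
    rw [show deriv (fun y => φ t y) = fun y => fderiv ℝ f (t, y) (0, 1) from funext (h1' t)]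
    exact (h3 t x).deriv
  refine ⟨f, fun q => fderiv ℝ f q (0, 1), fun q => fderiv ℝ f q (1, 0),
    fun p => fderiv ℝ (fun q => fderiv ℝ f q (0, 1)) p (0, 1),
    fun p => fderiv ℝ (fun q => fderiv ℝ f q (0, 1)) p (1, 0),
    hφ.of_le (by exact_mod_cast le_top), hX.of_le (by exact_mod_cast le_top),
    hT.of_le (by exact_mod_cast le_top), fun _ _ => rfl, h1, h2, h3,
    fun t x => hasDerivAt_fst_of_differentiableAt (hdX (t, x)), fun t x => ?_, ?_, ?_, ?_⟩
  · have := hasDerivAt_snd_of_differentiableAt (hdT (t, x))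
    rwa [fderiv_fderiv_apply_comm hφ] at this
  · intro t ht x hx
    have := hpde t ht x hx
    rwa [h1', h2', h3'] at this
  · intro t ht
    have := hbc0 t ht
    rwa [h1', h2'] at this
  · intro t ht
    have := hbc1 t ht
    rwa [h1', h2'] at this

lemma carl_interior_le {T ε a s t x fxx fxt : ℝ} {f fx ft : ℝ × ℝ → ℝ}
    (hT : 0 < T) (ha : 0 ≤ a) (hε : ε ∈ Ioo (0 : ℝ) 1)
    (hs : 1000 * ((T + T ^ 2) / ε + √a * T ^ 2 / √ε) ≤ s) (hs0 : 0 < s)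
    (ht : t ∈ Ioo 0 T) (hx : x ∈ Ioo (-1 : ℝ) 0)
    (hf : ContDiff ℝ 1 f) (hfx : ContDiff ℝ 1 fx) (hft : ContDiff ℝ 1 ft)
    (h1 : HasDerivAt (fun y => f (t, y)) (fx (t, x)) x)
    (h2 : HasDerivAt (fun τ => f (τ, x)) (ft (t, x)) t)
    (h3 : HasDerivAt (fun y => fx (t, y)) fxx x)
    (h4 : HasDerivAt (fun τ => fx (τ, x)) fxt t)
    (h5 : HasDerivAt (fun y => ft (t, y)) fxt x)
    (hpde : ft (t, x) + fx (t, x) + ε * fxx - a * f (t, x) = 0) :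
    s⁻¹ * (carlE T (2 * s) (t, x) * ((carlW T t x)⁻¹ * ft (t, x) ^ 2))
      + ε ^ 2 * s ^ 3 * (carlE T (2 * s) (t, x) * (carlW T t x ^ 3 * f (t, x) ^ 2))
    ≤ -6 * (fderiv ℝ (fun p => carlE T (2 * s) p * carlFluxT T ε a s f fx p) (t, x) (1, 0)
      + fderiv ℝ (fun p => carlE T (2 * s) p * carlFluxX T ε a s f fx ft p) (t, x) (0, 1)) := by
  have hx1 : x < 1 := hx.2.trans one_pos
  have hs2 : 0 < 2 * s := by positivity
  have hb := carlBounds_of_le hT ha hε hs ht (Ioo_subset_Icc_self hx)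
  rw [carlFlux_divergence hs0 ht hx1
    ((carlFluxT_tame hf hfx _ hs2 (t, x) hx1).differentiableAt one_ne_zero)
    ((carlFluxX_tame hf hfx hft _ hs2 (t, x) hx1).differentiableAt one_ne_zero) h1 h3 h5 h2 h4]
  have key := mul_le_mul_of_nonneg_left (hb.interior_le (f := f (t, x))
    (p := conjX T s f fx (t, x))
    (L₁ := ε * (fxx + 2 * (s * carlW T t x) * fx (t, x)
            + ((s * carlW T t x) ^ 2 + s * carlW T t x) * f (t, x))
          + conjPotential T ε a s (t, x) * f (t, x))
    (L₂ := conjT T s f ft (t, x) + conjDrift T ε s (t, x) * conjX T s f fx (t, x))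
    (by simp only [conjPotential, conjT, conjX, conjDrift]; linear_combination hpde)
    hb.drift_le) (carlE_nonneg T (2 * s) (t, x))
  refine le_trans (le_of_eq ?_) (key.trans_eq (by ring))
  simp only [conjT, conjX, conjDrift, mul_inv]
  ring

lemma carl_boundary_le {T ε a s t : ℝ} {f fx ft : ℝ × ℝ → ℝ}
    (hT : 0 < T) (ha : 0 ≤ a) (hε : ε ∈ Ioo (0 : ℝ) 1)
    (hs : 1000 * ((T + T ^ 2) / ε + √a * T ^ 2 / √ε) ≤ s) (hs0 : 0 < s) (ht : t ∈ Ioo 0 T)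
    (hbc0 : ε * (ft (t, 0) - fx (t, 0)) - f (t, 0) = 0)
    (hbc1 : ft (t, -1) + fx (t, -1) = 0) :
    ε ^ 2 * s ^ 3 * (carlE T (2 * s) (t, 0) * (carlW T t 0 ^ 3 * f (t, 0) ^ 2)
        + carlE T (2 * s) (t, -1) * (carlW T t (-1) ^ 3 * f (t, -1) ^ 2))
      + ε ^ 2 * s * (carlE T (2 * s) (t, -1) * (carlW T t (-1) * fx (t, -1) ^ 2))
      + -6 * (carlE T (2 * s) (t, 0) * carlFluxX T ε a s f fx ft (t, 0)
        - carlE T (2 * s) (t, -1) * carlFluxX T ε a s f fx ft (t, -1))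
    ≤ 100 * (ε ^ 2 * s ^ 3
          * (carlE T (2 * s) (t, 0) * ((carlW T t 0 ^ 3 + T ^ 2 * carlW T t 0 ^ 5) * f (t, 0) ^ 2))
        + ε ^ 2 * s * (carlE T (2 * s) (t, 0) * (carlW T t 0 * ft (t, 0) ^ 2))) := by
  have hl := mul_le_mul_of_nonneg_left
    ((carlBounds_of_le hT ha hε hs ht (by norm_num : (-1 : ℝ) ∈ Icc (-1) 0)).left_boundary_le
      (p := conjX T s f fx (t, -1)) (q := conjT T s f ft (t, -1)) rfl rfl hbc1)
    (carlE_nonneg T (2 * s) (t, -1))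
  have hr := mul_le_mul_of_nonneg_left
    ((carlBounds_of_le hT ha hε hs ht (by norm_num : (0 : ℝ) ∈ Icc (-1) 0)).right_boundary_le
      (p := conjX T s f fx (t, 0)) (q := conjT T s f ft (t, 0)) rfl rfl hbc0
      (carlK_zero_sq_le hT hε.1 hs0 ht))
    (carlE_nonneg T (2 * s) (t, 0))
  simp only [carlFluxX, conjDrift, conjPotential]
  linarith

/-- Intermediate Carleman estimate with a boundary time-derivative term. -/
theorem intermediate_carleman_estimate :
    ∃ C > (0:ℝ), ∃ s0 > (0:ℝ), ∀ T > (0:ℝ), ∀ a ≥ (0:ℝ), ∀ ε ∈ Set.Ioo (0:ℝ) 1,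
      ∀ s ≥ s0 * ((T + T ^ 2) / ε + Real.sqrt a * T ^ 2 / Real.sqrt ε),
      ∀ φ : ℝ → ℝ → ℝ, IsAdjSol1D T ε a φ →
        s⁻¹ * (∫ t in (0:ℝ)..T, ∫ x in (-1:ℝ)..0,
              (carlW T t x)⁻¹ * Real.exp (-2 * s * carlA T t x)
                * (deriv (fun τ => φ τ x) t) ^ 2)
          + ε ^ 2 * s ^ 3 *
              ((∫ t in (0:ℝ)..T, ∫ x in (-1:ℝ)..0,
                  carlW T t x ^ 3 * Real.exp (-2 * s * carlA T t x) * φ t x ^ 2)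
                + ∫ t in (0:ℝ)..T,
                    carlW T t 0 ^ 3 * Real.exp (-2 * s * carlA T t 0) * φ t 0 ^ 2
                    + carlW T t (-1) ^ 3 * Real.exp (-2 * s * carlA T t (-1))
                        * φ t (-1) ^ 2)
          + ε ^ 2 * s * (∫ t in (0:ℝ)..T,
              carlW T t (-1) * Real.exp (-2 * s * carlA T t (-1))
                * (deriv (fun y => φ t y) (-1)) ^ 2)
        ≤ C * (ε ^ 2 * s ^ 3 * (∫ t in (0:ℝ)..T,
              (carlW T t 0 ^ 3 + T ^ 2 * carlW T t 0 ^ 5)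
                * Real.exp (-2 * s * carlA T t 0) * φ t 0 ^ 2)
            + ε ^ 2 * s * ∫ t in (0:ℝ)..T,
                carlW T t 0 * Real.exp (-2 * s * carlA T t 0)
                  * (deriv (fun τ => φ τ 0) t) ^ 2) := by
  refine ⟨100, by norm_num, 1000, by norm_num, ?_⟩
  intro T hT a ha ε hε s hs φ hφ
  obtain ⟨f, fx, ft, fxx, fxt, hf, hfx, hft, hφf, h1, h2, h3, h4, h5, hpde, hbc0, hbc1⟩ :=
    hφ.exists_derivatives
  have hs0 : 0 < s := by
    refine lt_of_lt_of_le ?_ hs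
    have : 0 < (T + T ^ 2) / ε := div_pos (by positivity) hε.1
    positivity
  have hs2 : 0 < 2 * s := by positivity
  have hE : ∀ t ∈ Ioo 0 T, ∀ x < 1, exp (-2 * s * carlA T t x) = carlE T (2 * s) (t, x) :=
    fun t ht x hx => by rw [carlE_eq_exp hs2 ht hx, neg_mul 2 s]
  have hdt : ∀ t x, deriv (fun τ => φ τ x) t = ft (t, x) := fun t x => by
    simp only [hφf]
    exact (h2 t x).deriv
  have hdx : ∀ t x, deriv (fun y => φ t y) x = fx (t, x) := fun t x => by
    simp only [hφf]
    exact (h1 t x).deriv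
  have tf := CarlTame.of_contDiff (T := T) hf
  have tfx := CarlTame.of_contDiff (T := T) hfx
  have tft := CarlTame.of_contDiff (T := T) hft
  have c1 := ((CarlTame.carlW_inv (T := T)).mul (tft.pow 2)).continuousOn hs2
  have c2 := (((CarlTame.carlW (T := T)).pow 3).mul (tf.pow 2)).continuousOn hs2
  have c3 := ((CarlTame.carlW (T := T)).mul (tfx.pow 2)).continuousOn hs2
  have c4 := ((((CarlTame.carlW (T := T)).pow 3).add ((CarlTame.const (T ^ 2)).mul
    ((CarlTame.carlW (T := T)).pow 5))).mul (tf.pow 2)).continuousOn hs2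
  have c5 := ((CarlTame.carlW (T := T)).mul (tft.pow 2)).continuousOn hs2
  have tQ := carlFluxX_tame (T := T) (ε := ε) (a := a) (s := s) hf hfx hft
  have cQ := tQ.continuousOn hs2
  obtain ⟨cD, hdiv⟩ := integral_divergence_carlE hT hs2
    (carlFluxT_tame (T := T) (ε := ε) (a := a) (s := s) hf hfx) tQ
  have e1 : (∫ t in (0:ℝ)..T, ∫ x in (-1:ℝ)..0,
      (carlW T t x)⁻¹ * exp (-2 * s * carlA T t x) * (deriv (fun τ => φ τ x) t) ^ 2)
      = ∫ t in (0:ℝ)..T, ∫ x in (-1:ℝ)..0,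
        carlE T (2 * s) (t, x) * ((carlW T t x)⁻¹ * ft (t, x) ^ 2) :=
    integral_integral_congr hT fun t ht x hx => by
      rw [hE t ht x (hx.2.trans one_pos), hdt]
      ring
  have e2 : (∫ t in (0:ℝ)..T, ∫ x in (-1:ℝ)..0,
      carlW T t x ^ 3 * exp (-2 * s * carlA T t x) * φ t x ^ 2)
      = ∫ t in (0:ℝ)..T, ∫ x in (-1:ℝ)..0,
        carlE T (2 * s) (t, x) * (carlW T t x ^ 3 * f (t, x) ^ 2) :=
    integral_integral_congr hT fun t ht x hx => by
      rw [hE t ht x (hx.2.trans one_pos), hφf]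
      ring
  have e3 : (∫ t in (0:ℝ)..T, carlW T t 0 ^ 3 * exp (-2 * s * carlA T t 0) * φ t 0 ^ 2
      + carlW T t (-1) ^ 3 * exp (-2 * s * carlA T t (-1)) * φ t (-1) ^ 2)
      = ∫ t in (0:ℝ)..T, (carlE T (2 * s) (t, 0) * (carlW T t 0 ^ 3 * f (t, 0) ^ 2)
        + carlE T (2 * s) (t, -1) * (carlW T t (-1) ^ 3 * f (t, -1) ^ 2)) :=
    intervalIntegral.integral_congr_Ioo_of_le hT.le fun t ht => by
      simp only [hE t ht 0 one_pos, hE t ht (-1) (by norm_num), hφf]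
      ring
  have e4 : (∫ t in (0:ℝ)..T, carlW T t (-1) * exp (-2 * s * carlA T t (-1))
      * (deriv (fun y => φ t y) (-1)) ^ 2)
      = ∫ t in (0:ℝ)..T, carlE T (2 * s) (t, -1) * (carlW T t (-1) * fx (t, -1) ^ 2) :=
    intervalIntegral.integral_congr_Ioo_of_le hT.le fun t ht => by
      simp only [hE t ht (-1) (by norm_num), hdx]
      ring
  have e5 : (∫ t in (0:ℝ)..T, (carlW T t 0 ^ 3 + T ^ 2 * carlW T t 0 ^ 5)
      * exp (-2 * s * carlA T t 0) * φ t 0 ^ 2)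
      = ∫ t in (0:ℝ)..T, carlE T (2 * s) (t, 0)
        * ((carlW T t 0 ^ 3 + T ^ 2 * carlW T t 0 ^ 5) * f (t, 0) ^ 2) :=
    intervalIntegral.integral_congr_Ioo_of_le hT.le fun t ht => by
      simp only [hE t ht 0 one_pos, hφf]
      ring
  have e6 : (∫ t in (0:ℝ)..T, carlW T t 0 * exp (-2 * s * carlA T t 0)
      * (deriv (fun τ => φ τ 0) t) ^ 2)
      = ∫ t in (0:ℝ)..T, carlE T (2 * s) (t, 0) * (carlW T t 0 * ft (t, 0) ^ 2) :=
    intervalIntegral.integral_congr_Ioo_of_le hT.le fun t ht => by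
      simp only [hE t ht 0 one_pos, hdt]
      ring
  rw [e1, e2, e3, e4, e5, e6]
  have hsub : Ioo 0 T ×ˢ Ioo (-1 : ℝ) 0 ⊆ Icc 0 T ×ˢ Icc (-1 : ℝ) 0 :=
    prod_mono Ioo_subset_Icc_self Ioo_subset_Icc_self
  have hint := setIntegral_mono_on
    (((integrableOn_rectangle (T := T) c1).mono_set hsub).const_mul s⁻¹ |>.add
      (((integrableOn_rectangle (T := T) c2).mono_set hsub).const_mul (ε ^ 2 * s ^ 3)))
    (((integrableOn_rectangle (T := T) cD).mono_set hsub).const_mul (-6))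
    (measurableSet_Ioo.prod measurableSet_Ioo)
    (fun p hp => carl_interior_le hT ha hε hs hs0 hp.1 hp.2 hf hfx hft (h1 _ _) (h2 _ _)
      (h3 _ _) (h4 _ _) (h5 _ _) (hpde p.1 hp.1 p.2 hp.2))
  simp only [Pi.add_apply] at hint
  rw [integral_add (((integrableOn_rectangle (T := T) c1).mono_set hsub).const_mul s⁻¹)
      (((integrableOn_rectangle (T := T) c2).mono_set hsub).const_mul (ε ^ 2 * s ^ 3)),
    MeasureTheory.integral_const_mul, MeasureTheory.integral_const_mul,
    MeasureTheory.integral_const_mul,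
    ← integral_integral_eq_setIntegral hT c1, ← integral_integral_eq_setIntegral hT c2,
    ← integral_integral_eq_setIntegral hT cD, hdiv] at hint
  have n1 : (-1 : ℝ) < 1 := by norm_num
  have i0 := intervalIntegrable_trace (T := T) c2 one_pos
  have i1 := intervalIntegrable_trace (T := T) c2 n1
  have i2 := intervalIntegrable_trace (T := T) c3 n1
  have i3 := intervalIntegrable_trace (T := T) c4 one_pos
  have i4 := intervalIntegrable_trace (T := T) c5 one_pos
  have q0 := intervalIntegrable_trace (T := T) cQ one_pos
  have q1 := intervalIntegrable_trace (T := T) cQ n1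
  have j1 := (i0.add i1).const_mul (ε ^ 2 * s ^ 3)
  have j2 := i2.const_mul (ε ^ 2 * s)
  have j3 := (q0.sub q1).const_mul (-6)
  have j4 := i3.const_mul (ε ^ 2 * s ^ 3)
  have j5 := i4.const_mul (ε ^ 2 * s)
  have hbdry := intervalIntegral.integral_mono_on_of_le_Ioo hT.le ((j1.add j2).add j3)
    ((j4.add j5).const_mul 100)
    (fun t ht => carl_boundary_le hT ha hε hs hs0 ht (hbc0 t ht) (hbc1 t ht))
  rw [intervalIntegral.integral_add (j1.add j2) j3, intervalIntegral.integral_add j1 j2,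
    intervalIntegral.integral_const_mul, intervalIntegral.integral_const_mul,
    intervalIntegral.integral_const_mul, intervalIntegral.integral_const_mul,
    intervalIntegral.integral_add j4 j5, intervalIntegral.integral_const_mul,
    intervalIntegral.integral_const_mul, intervalIntegral.integral_sub q0 q1] at hbdry
  linarith
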